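/- A tail measure ν with index α > 0 is shift-invariant if and only if p_h := ν({x : ‖x_h‖ > 1}) = 1 for all h ∈ ℤ and the local spectral tail process at lag h satisfies Θ^{(h)} =_d B^h Θ for all h ∈ ℤ, where Θ = Θ^{(0)} is the spectral tail process. -/

import Mathlib

open MeasureTheory
open scoped ENNReal

/-- A measurable cone: a measurable space `E` with a measurable multiplication by positive
scalars, a zero element and a measurable `1`-homogeneous pseudonorm. -/
structure MeasCone (E : Type*) [MeasurableSpace E] where
  smul : ℝ → E → E
  zero : E
  nrm : E → ℝ
  measurable_smul : Measurable fun p : ℝ × E => smul p.1 p.2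
  measurable_nrm : Measurable nrm
  one_smul : ∀ x, smul 1 x = x
  smul_smul : ∀ (u v : ℝ), 0 < u → 0 < v → ∀ x, smul u (smul v x) = smul (u * v) x
  smul_zero' : ∀ (u : ℝ), 0 < u → smul u zero = zero
  nrm_nonneg : ∀ x, 0 ≤ nrm x
  nrm_smul : ∀ (u : ℝ), 0 < u → ∀ x, nrm (smul u x) = u * nrm x
  eq_zero_of_nrm : ∀ x, nrm x = 0 → x = zero

/-- The `k`-th iterate of the backshift operator: `(B^k x)_h = x_{h-k}`. -/
def seqShift {E : Type*} (k : ℤ) (x : ℤ → E) : ℤ → E := fun h => x (h - k)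

/-- Shift invariance of a measure on `E^ℤ`: `ν(BA) = ν(A)` for all measurable `A`. -/
def ShiftInvariant {E : Type*} [MeasurableSpace E] (ν : MeasureTheory.Measure (ℤ → E)) : Prop :=
  ∀ A : Set (ℤ → E), MeasurableSet A → ν (seqShift 1 '' A) = ν A

namespace MeasCone

variable {E : Type*} [MeasurableSpace E] (K : MeasCone E)

/-- The sequence identically equal to the zero element. -/
def zeroSeq : ℤ → E := fun _ => K.zero

/-- Componentwise scalar multiplication on the sequence space `E^ℤ`. -/
def sSmul (u : ℝ) (x : ℤ → E) : ℤ → E := fun h => K.smul u (x h)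


/-- A tail measure with index `α > 0` on `E^ℤ`. -/
def IsTailMeasure (α : ℝ) (ν : Measure (ℤ → E)) : Prop :=
  ν {K.zeroSeq} = 0 ∧
  ν {x | 1 < K.nrm (x 0)} = 1 ∧
  (∀ h : ℤ, ν {x | 1 < K.nrm (x h)} < ⊤) ∧
  ∀ (u : ℝ), 0 < u → ∀ A : Set (ℤ → E), MeasurableSet A →
    ν (K.sSmul u '' A) = ENNReal.ofReal (u ^ (-α)) * ν A

/-- The spectral map at lag `h`: `x ↦ x / ‖x_h‖`. -/
noncomputable def spectralMap (h : ℤ) (x : ℤ → E) : ℤ → E :=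
  fun j => K.smul (K.nrm (x h))⁻¹ (x j)

/-- The law of the local spectral tail process of `ν` at lag `h`:
the pushforward under the spectral map of (the normalization of) the restriction of `ν`
to `{x : ‖x_h‖ > 1}`. -/
noncomputable def spectralLaw (ν : Measure (ℤ → E)) (h : ℤ) : Measure (ℤ → E) :=
  Measure.map (K.spectralMap h)
    ((ν {x | 1 < K.nrm (x h)})⁻¹ • ν.restrict {x | 1 < K.nrm (x h)})

/-- The time change formula for (the law of) a process `Θ`:
`E[H₀(B^h Θ)] = E[‖Θ_h‖^α H₀(Θ)]` for every measurable `0`-homogeneous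
`H₀ : E^ℤ → [0,∞)` vanishing on `{x : ‖x_0‖ = 0}`. -/
def SatisfiesTCF (α : ℝ) (μ : Measure (ℤ → E)) : Prop :=
  ∀ (h : ℤ) (H : (ℤ → E) → ℝ), Measurable H → (∀ x, 0 ≤ H x) →
    (∀ (u : ℝ), 0 < u → ∀ x, H (K.sSmul u x) = H x) →
    (∀ x, K.nrm (x 0) = 0 → H x = 0) →
    ∫⁻ x, ENNReal.ofReal (H (seqShift h x)) ∂μ
      = ∫⁻ x, ENNReal.ofReal (K.nrm (x h) ^ α) * ENNReal.ofReal (H x) ∂μ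

/-- `I(x) = j ∈ ℤ` for the infargmax functional:
`sup_{k ≤ j-1} ‖x_k‖ < ‖x_j‖ = sup_{k ∈ ℤ} ‖x_k‖`. -/
def IsInfArgmax (x : ℤ → E) (j : ℤ) : Prop :=
  (⨆ k : ℤ, ⨆ _ : k < j, ENNReal.ofReal (K.nrm (x k))) < ENNReal.ofReal (K.nrm (x j)) ∧
  ENNReal.ofReal (K.nrm (x j)) = ⨆ k : ℤ, ENNReal.ofReal (K.nrm (x k))

end MeasCone

section SeqShift

variable {E : Type*}

lemma seqShift_comp (k l : ℤ) :
    (seqShift k : (ℤ → E) → ℤ → E) ∘ seqShift l = seqShift (k + l) := by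
  funext x j
  simp only [Function.comp, seqShift]
  congr 1
  ring

lemma seqShift_zero : (seqShift 0 : (ℤ → E) → ℤ → E) = id := by
  funext x j
  simp [seqShift]

lemma seqShift_image (k : ℤ) (A : Set (ℤ → E)) : seqShift k '' A = seqShift (-k) ⁻¹' A := by
  refine congrFun (Set.image_eq_preimage_of_inverse (fun x => ?_) (fun x => ?_)) A
  · simpa [seqShift_zero] using congrFun (seqShift_comp (-k) k) x
  · simpa [seqShift_zero] using congrFun (seqShift_comp k (-k)) x

variable [MeasurableSpace E]

lemma measurable_seqShift (k : ℤ) : Measurable (seqShift k : (ℤ → E) → ℤ → E) :=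
  measurable_pi_lambda _ fun _ => measurable_pi_apply _

lemma map_seqShift_map (ν : Measure (ℤ → E)) (k l : ℤ) :
    (ν.map (seqShift l)).map (seqShift k) = ν.map (seqShift (k + l)) := by
  rw [Measure.map_map (measurable_seqShift k) (measurable_seqShift l), seqShift_comp]

/-- Shift invariance amounts to invariance under pushforward by the backshift. -/
lemma shiftInvariant_iff_map_eq (ν : Measure (ℤ → E)) :
    ShiftInvariant ν ↔ ν.map (seqShift 1) = ν := by
  have key : ShiftInvariant ν ↔ ν.map (seqShift (-1)) = ν := by
    rw [Measure.ext_iff]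
    refine forall₂_congr fun A hA => ?_
    rw [seqShift_image, Measure.map_apply (measurable_seqShift _) hA]
  rw [key]
  constructor <;> intro h <;>
  · conv_lhs => rw [← h]
    simp [map_seqShift_map, seqShift_zero]

lemma ShiftInvariant.map_seqShift {ν : Measure (ℤ → E)} (hν : ShiftInvariant ν) (k : ℤ) :
    ν.map (seqShift k) = ν := by
  have h1 := (shiftInvariant_iff_map_eq ν).1 hν
  induction k with
  | zero => simp [seqShift_zero]
  | succ n ih => rw [← map_seqShift_map, h1, ih]
  | pred n ih =>
    conv_lhs => rw [← h1]
    rw [map_seqShift_map, sub_add_cancel, ih]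

end SeqShift

namespace MeasCone

variable {E : Type*} [MeasurableSpace E] (K : MeasCone E)

lemma nrm_zero : K.nrm K.zero = 0 := by
  have h := K.nrm_smul 2 two_pos K.zero
  rw [K.smul_zero' 2 two_pos] at h
  linarith

lemma measurable_nrm_apply (h : ℤ) : Measurable fun x : ℤ → E => K.nrm (x h) :=
  K.measurable_nrm.comp (measurable_pi_apply h)

lemma measurableSet_lt_nrm (r : ℝ) (h : ℤ) : MeasurableSet {x : ℤ → E | r < K.nrm (x h)} :=
  measurableSet_lt measurable_const (K.measurable_nrm_apply h)

lemma measurable_uncurry_sSmul :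
    Measurable fun p : ℝ × (ℤ → E) => K.sSmul p.1 p.2 :=
  measurable_pi_lambda _ fun j => K.measurable_smul.comp
    (measurable_fst.prodMk ((measurable_pi_apply j).comp measurable_snd))

lemma measurable_sSmul (u : ℝ) : Measurable (K.sSmul u) :=
  K.measurable_uncurry_sSmul.comp (measurable_const.prodMk measurable_id)

lemma measurable_spectralMap (h : ℤ) : Measurable (K.spectralMap h) :=
  K.measurable_uncurry_sSmul.comp ((K.measurable_nrm_apply h).inv.prodMk measurable_id)

lemma sSmul_sSmul {u v : ℝ} (hu : 0 < u) (hv : 0 < v) (x : ℤ → E) :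
    K.sSmul u (K.sSmul v x) = K.sSmul (u * v) x :=
  funext fun j => K.smul_smul u v hu hv (x j)

lemma one_sSmul (x : ℤ → E) : K.sSmul 1 x = x :=
  funext fun j => K.one_smul (x j)

lemma sSmul_image {u : ℝ} (hu : 0 < u) (A : Set (ℤ → E)) :
    K.sSmul u '' A = K.sSmul u⁻¹ ⁻¹' A := by
  have hu' : 0 < u⁻¹ := inv_pos.2 hu
  refine congrFun (Set.image_eq_preimage_of_inverse (fun x => ?_) (fun x => ?_)) A
  · rw [K.sSmul_sSmul hu' hu, inv_mul_cancel₀ hu.ne', one_sSmul]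
  · rw [K.sSmul_sSmul hu hu', mul_inv_cancel₀ hu.ne', one_sSmul]

lemma sSmul_spectralMap {h : ℤ} {x : ℤ → E} (hx : 0 < K.nrm (x h)) :
    K.sSmul (K.nrm (x h)) (K.spectralMap h x) = x := by
  change K.sSmul _ (K.sSmul (K.nrm (x h))⁻¹ x) = x
  rw [K.sSmul_sSmul hx (inv_pos.2 hx), mul_inv_cancel₀ hx.ne', one_sSmul]

lemma spectralMap_sSmul {h : ℤ} {x : ℤ → E} {u : ℝ} (hu : 0 < u) (hx : 0 < K.nrm (x h)) :
    K.spectralMap h (K.sSmul u x) = K.spectralMap h x := by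
  change K.sSmul (K.nrm (K.smul u (x h)))⁻¹ (K.sSmul u x) = K.sSmul (K.nrm (x h))⁻¹ x
  rw [K.nrm_smul u hu, K.sSmul_sSmul (inv_pos.2 (mul_pos hu hx)) hu]
  congr 1
  field_simp

/-- Homogeneity of index `-α`, in terms of preimages under scaling. -/
def IsHomogeneous (α : ℝ) (ν : Measure (ℤ → E)) : Prop :=
  ∀ (u : ℝ), 0 < u → ∀ A : Set (ℤ → E), MeasurableSet A →
    ν (K.sSmul u ⁻¹' A) = ENNReal.ofReal (u ^ α) * ν A

variable {K} {α : ℝ} {μ ν : Measure (ℤ → E)}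

lemma IsTailMeasure.isHomogeneous (hν : K.IsTailMeasure α ν) : K.IsHomogeneous α ν := by
  intro u hu A hA
  have h := hν.2.2.2 u⁻¹ (inv_pos.2 hu) A hA
  rwa [K.sSmul_image (inv_pos.2 hu), inv_inv, Real.inv_rpow hu.le, Real.rpow_neg hu.le,
    inv_inv] at h

lemma IsHomogeneous.map_seqShift (hν : K.IsHomogeneous α ν) (k : ℤ) :
    K.IsHomogeneous α (ν.map (seqShift k)) := by
  intro u hu A hA
  rw [Measure.map_apply (measurable_seqShift k) (K.measurable_sSmul u hA),
    Measure.map_apply (measurable_seqShift k) hA, ← hν u hu _ (measurable_seqShift k hA)]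
  rfl

lemma lt_nrm_map_seqShift (ν : Measure (ℤ → E)) (k h : ℤ) :
    ν.map (seqShift k) {x | 1 < K.nrm (x h)} = ν {x | 1 < K.nrm (x (h - k))} := by
  rw [Measure.map_apply (measurable_seqShift k) (K.measurableSet_lt_nrm 1 h)]
  rfl

lemma spectralLaw_map_seqShift (ν : Measure (ℤ → E)) (k h : ℤ) :
    K.spectralLaw (ν.map (seqShift k)) h = (K.spectralLaw ν (h - k)).map (seqShift k) := by
  rw [spectralLaw, spectralLaw, lt_nrm_map_seqShift,
    Measure.restrict_map (measurable_seqShift k) (K.measurableSet_lt_nrm 1 h),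
    ← Measure.map_smul, Measure.map_map (K.measurable_spectralMap h) (measurable_seqShift k),
    Measure.map_map (measurable_seqShift k) (K.measurable_spectralMap (h - k))]
  rfl

lemma spectralLaw_apply {h : ℤ} (hν : ν {x | 1 < K.nrm (x h)} = 1) {B : Set (ℤ → E)}
    (hB : MeasurableSet B) :
    K.spectralLaw ν h B = ν (K.spectralMap h ⁻¹' B ∩ {x | 1 < K.nrm (x h)}) := by
  rw [spectralLaw, hν, inv_one, _root_.one_smul, Measure.map_apply (K.measurable_spectralMap h) hB,
    Measure.restrict_apply (K.measurable_spectralMap h hB)]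

/-- The polar decomposition on a radial tail: the radius has a Pareto tail and is independent of
the spectral component. -/
lemma IsHomogeneous.polar_apply (hν : K.IsHomogeneous α ν) {h : ℤ}
    (h1 : ν {x | 1 < K.nrm (x h)} = 1) {r : ℝ} (hr : 0 < r) {B : Set (ℤ → E)}
    (hB : MeasurableSet B) :
    ν (K.spectralMap h ⁻¹' B ∩ {x | r < K.nrm (x h)})
      = ENNReal.ofReal (r⁻¹ ^ α) * K.spectralLaw ν h B := by
  have hr' : 0 < r⁻¹ := inv_pos.2 hr
  rw [spectralLaw_apply h1 hB, ← hν r⁻¹ hr' _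
    ((K.measurable_spectralMap h hB).inter (K.measurableSet_lt_nrm 1 h))]
  congr 1
  ext x
  have hn : 1 < K.nrm (K.sSmul r⁻¹ x h) ↔ r < K.nrm (x h) := by
    change 1 < K.nrm (K.smul r⁻¹ (x h)) ↔ _
    rw [K.nrm_smul _ hr', inv_mul_eq_div, one_lt_div hr]
  simp only [Set.mem_inter_iff, Set.mem_preimage, Set.mem_ofPred_eq, hn]
  refine and_congr_left fun hx => ?_
  rw [K.spectralMap_sSmul hr' (hr.trans hx)]

/-- Away from `‖x_h‖ = 0`, a homogeneous measure is determined by its spectral law at lag `h`. -/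
lemma IsHomogeneous.restrict_eq (hμ : K.IsHomogeneous α μ) (hν : K.IsHomogeneous α ν) {h : ℤ}
    (hμ1 : μ {x | 1 < K.nrm (x h)} = 1) (hν1 : ν {x | 1 < K.nrm (x h)} = 1)
    (hμν : K.spectralLaw μ h = K.spectralLaw ν h) {r : ℝ} (hr : 0 < r) :
    μ.restrict {x | r < K.nrm (x h)} = ν.restrict {x | r < K.nrm (x h)} := by
  have hD := K.measurableSet_lt_nrm r h
  have hfin {ρ : Measure (ℤ → E)} (hρ : K.IsHomogeneous α ρ)
      (hρ1 : ρ {x | 1 < K.nrm (x h)} = 1) :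
      IsFiniteMeasure (ρ.restrict {x | r < K.nrm (x h)}) := by
    constructor
    have := hρ.polar_apply hρ1 hr MeasurableSet.univ
    rw [Set.preimage_univ, Set.univ_inter, spectralLaw_apply hρ1 MeasurableSet.univ,
      Set.preimage_univ, Set.univ_inter, hρ1, mul_one] at this
    rw [Measure.restrict_apply_univ, this]
    exact ENNReal.ofReal_lt_top
  have := hfin hμ hμ1
  have := hfin hν hν1
  have hs (B : Set (ℤ → E)) (hB : MeasurableSet B) :
      ((μ.restrict {x | r < K.nrm (x h)}).restrict (K.spectralMap h ⁻¹' B)).map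
          (fun x => K.nrm (x h))
        = ((ν.restrict {x | r < K.nrm (x h)}).restrict (K.spectralMap h ⁻¹' B)).map
          (fun x => K.nrm (x h)) := by
    have hB' := K.measurable_spectralMap h hB
    have hval {ρ : Measure (ℤ → E)} (hρ : K.IsHomogeneous α ρ)
        (hρ1 : ρ {x | 1 < K.nrm (x h)} = 1) (a : ℝ) :
        ((ρ.restrict {x | r < K.nrm (x h)}).restrict (K.spectralMap h ⁻¹' B)).map
          (fun x => K.nrm (x h)) (Set.Ioi a)
        = ENNReal.ofReal ((max a r)⁻¹ ^ α) * K.spectralLaw ρ h B := by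
      rw [← hρ.polar_apply hρ1 (lt_max_of_lt_right hr) hB,
        Measure.map_apply (K.measurable_nrm_apply h) measurableSet_Ioi,
        Measure.restrict_apply (K.measurable_nrm_apply h measurableSet_Ioi),
        Measure.restrict_apply ((K.measurable_nrm_apply h measurableSet_Ioi).inter hB')]
      congr 1
      ext x
      simp only [Set.mem_inter_iff, Set.mem_preimage, Set.mem_ofPred_eq, Set.mem_Ioi, max_lt_iff]
      tauto
    refine ext_of_generate_finite _ (borel_eq_generateFrom_Ioi ℝ ▸ BorelSpace.measurable_eq)
      isPiSystem_Ioi ?_ ?_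
    · rintro _ ⟨a, rfl⟩
      rw [hval hμ hμ1, hval hν hν1, hμν]
    · rw [Measure.map_apply (K.measurable_nrm_apply h) MeasurableSet.univ,
        Measure.map_apply (K.measurable_nrm_apply h) MeasurableSet.univ, Set.preimage_univ,
        Measure.restrict_apply_univ, Measure.restrict_apply_univ, Measure.restrict_apply hB',
        Measure.restrict_apply hB', hμ.polar_apply hμ1 hr hB, hν.polar_apply hν1 hr hB, hμν]
  have hφ : Measurable fun x : ℤ → E => (K.nrm (x h), K.spectralMap h x) :=
    (K.measurable_nrm_apply h).prodMk (K.measurable_spectralMap h)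
  have hpolar : (μ.restrict {x | r < K.nrm (x h)}).map
        (fun x => (K.nrm (x h), K.spectralMap h x))
      = (ν.restrict {x | r < K.nrm (x h)}).map (fun x => (K.nrm (x h), K.spectralMap h x)) := by
    refine Measure.ext_prod fun {S B} hS hB => ?_
    have hval := congrArg (fun ρ : Measure ℝ => ρ S) (hs B hB)
    rw [Measure.map_apply (K.measurable_nrm_apply h) hS,
      Measure.map_apply (K.measurable_nrm_apply h) hS,
      Measure.restrict_apply (K.measurable_nrm_apply h hS),
      Measure.restrict_apply (K.measurable_nrm_apply h hS)] at hval
    rw [Measure.map_apply hφ (hS.prod hB), Measure.map_apply hφ (hS.prod hB)]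
    exact hval
  have hrec (ρ : Measure (ℤ → E)) :
      ((ρ.restrict {x | r < K.nrm (x h)}).map (fun x => (K.nrm (x h), K.spectralMap h x))).map
        (fun p => K.sSmul p.1 p.2) = ρ.restrict {x | r < K.nrm (x h)} := by
    rw [Measure.map_map K.measurable_uncurry_sSmul hφ]
    conv_rhs => rw [← Measure.map_id (μ := ρ.restrict {x | r < K.nrm (x h)})]
    refine Measure.map_congr ?_
    filter_upwards [ae_restrict_mem hD] with x hx
    exact K.sSmul_spectralMap (hr.trans hx)
  rw [← hrec μ, hpolar, hrec ν]

/-- Two measures giving no mass to the zero sequence agree as soon as they agree on every set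
`{x : ‖x_h‖ > r}`, `r > 0`. -/
lemma measure_eq_of_restrict_eq (hμ : μ {K.zeroSeq} = 0) (hν : ν {K.zeroSeq} = 0)
    (hμν : ∀ (h : ℤ) (r : ℝ), 0 < r →
      μ.restrict {x | r < K.nrm (x h)} = ν.restrict {x | r < K.nrm (x h)}) : μ = ν := by
  let U : Set (ℤ → E) := ⋃ p : ℤ × ℕ, {x | 1 / ((p.2 : ℝ) + 1) < K.nrm (x p.1)}
  have hU : μ.restrict U = ν.restrict U :=
    Measure.restrict_iUnion_congr.2 fun p => hμν p.1 _ Nat.one_div_pos_of_nat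
  have hcompl : Uᶜ ⊆ {K.zeroSeq} := by
    intro x hx
    refine funext fun h => K.eq_zero_of_nrm _ (le_antisymm ?_ (K.nrm_nonneg _))
    by_contra! hpos
    obtain ⟨n, hn⟩ := exists_nat_one_div_lt hpos
    exact hx (Set.mem_iUnion.2 ⟨(h, n), hn⟩)
  have hfull {ρ : Measure (ℤ → E)} (hρ : ρ {K.zeroSeq} = 0) : ρ.restrict U = ρ :=
    Measure.restrict_eq_self_of_ae_mem
      (mem_ae_iff.2 (measure_mono_null hcompl hρ))
  rw [← hfull hμ, hU, hfull hν]

lemma seqShift_preimage_zeroSeq (k : ℤ) : seqShift k ⁻¹' {K.zeroSeq} = {K.zeroSeq} := by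
  ext x
  simp only [Set.mem_preimage, Set.mem_singleton_iff]
  refine ⟨fun hx => funext fun j => ?_, fun hx => by rw [hx]; rfl⟩
  simpa [seqShift, zeroSeq] using congrFun hx (j + k)

lemma measurableSet_zeroSeq : MeasurableSet {K.zeroSeq} := by
  have : {K.zeroSeq} = ⋂ h : ℤ, {x : ℤ → E | K.nrm (x h) = 0} := by
    ext x
    simp only [Set.mem_singleton_iff, Set.mem_iInter, Set.mem_ofPred_eq]
    exact ⟨fun hx h => by rw [hx]; exact K.nrm_zero,
      fun hx => funext fun h => K.eq_zero_of_nrm _ (hx h)⟩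
  rw [this]
  exact MeasurableSet.iInter fun h =>
    measurableSet_eq_fun (K.measurable_nrm_apply h) measurable_const

end MeasCone

open MeasCone in
/-- a tail measure `ν` is shift-invariant iff `p_h = 1` for all `h` and the local
spectral tail process at lag `h` has the law of `B^h Θ` for all `h`. -/
theorem shiftInvariant_iff_spectralLaw_shift
    {E : Type*} [MeasurableSpace E] (K : MeasCone E) (α : ℝ) (hα : 0 < α)
    (ν : Measure (ℤ → E)) (hν : K.IsTailMeasure α ν) :
    ShiftInvariant ν ↔
      ∀ h : ℤ, ν {x | 1 < K.nrm (x h)} = 1 ∧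
        K.spectralLaw ν h = Measure.map (seqShift h) (K.spectralLaw ν 0) := by
  constructor
  · intro hS h
    have hmap := hS.map_seqShift h
    constructor
    · rw [← hmap, lt_nrm_map_seqShift, sub_self, hν.2.1]
    · conv_lhs => rw [← hmap]
      rw [spectralLaw_map_seqShift, sub_self]
  · intro H
    rw [shiftInvariant_iff_map_eq]
    refine measure_eq_of_restrict_eq (K := K) ?_ hν.1 fun h r hr => ?_
    · rw [Measure.map_apply (measurable_seqShift 1) measurableSet_zeroSeq,
        seqShift_preimage_zeroSeq, hν.1]
    · refine (hν.isHomogeneous.map_seqShift 1).restrict_eq hν.isHomogeneous ?_ (H h).1 ?_ hr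
      · rw [lt_nrm_map_seqShift, (H (h - 1)).1]
      · rw [spectralLaw_map_seqShift, (H (h - 1)).2, map_seqShift_map, add_sub_cancel, (H h).2]
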